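/- arXiv:2105.05400 — 2 statements merged into one kernel-verified Lean document; each statement's English description precedes it below -/
import Mathlib

section
/- Let G be a finite group, let K ≤ G be a subgroup, and let (ρ,V) and (σ,W) be finite-dimensional unitary representations of K. Let L²(G;ρ) := {f : G → V | f(gk) = ρ(k)⁻¹ f(g) for all g ∈ G, k ∈ K}, and similarly L²(G;σ). Then every linear map φ : L²(G;ρ) → L²(G;σ) satisfying φ ∘ Λ(g) = Λ(g) ∘ φ for all g ∈ G is a convolutional layer: there exists κ : G → Hom(V,W) such that for every f ∈ L²(G;ρ) and every g ∈ G, (φ f)(g) = ∑_{g'∈G} κ(g⁻¹g')(f(g')). In other words, for finite G every G-equivariant layer is a convolutional layer. -/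
/-- Let `G` be a finite group, `K ≤ G` a subgroup, and `(ρ,V)`, `(σ,W)`
finite-dimensional unitary representations of `K`.  Let
`L²(G;ρ) = {f : G → V | f(gk) = ρ(k)⁻¹ f(g) for all g ∈ G, k ∈ K}` and similarly `L²(G;σ)`.
Then every linear map `φ : L²(G;ρ) → L²(G;σ)` commuting with left translation
(`φ ∘ Λ(g) = Λ(g) ∘ φ` for all `g ∈ G`) is a convolutional layer: there is a kernel
`κ : G → Hom(V,W)` with `(φ f)(g) = ∑_{g' ∈ G} κ(g⁻¹g')(f g')` for every `f ∈ L²(G;ρ)` and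
every `g ∈ G`.  For finite `G`, every `G`-equivariant layer is a convolutional layer. -/
theorem equivariant_layer_is_convolutional_finite
    {G : Type*} [Group G] [Fintype G]
    {V W : Type*} [NormedAddCommGroup V] [InnerProductSpace ℂ V] [FiniteDimensional ℂ V]
    [NormedAddCommGroup W] [InnerProductSpace ℂ W] [FiniteDimensional ℂ W]
    (K : Subgroup G)
    (ρ : K →* (V ≃ₗᵢ[ℂ] V)) (σ : K →* (W ≃ₗᵢ[ℂ] W))
    -- the induced-representation spaces `L²(G;ρ)` and `L²(G;σ)`:
    (Sρ : Submodule ℂ (G → V))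
    (hSρ : ∀ f : G → V, f ∈ Sρ ↔ ∀ (g : G) (k : K), f (g * (k : G)) = ρ k⁻¹ (f g))
    (Sσ : Submodule ℂ (G → W))
    (hSσ : ∀ f : G → W, f ∈ Sσ ↔ ∀ (g : G) (k : K), f (g * (k : G)) = σ k⁻¹ (f g))
    -- a linear map `φ : L²(G;ρ) → L²(G;σ)`:
    (φ : Sρ →ₗ[ℂ] Sσ)
    -- `φ` is `G`-equivariant: `φ ∘ Λ(g) = Λ(g) ∘ φ` for all `g ∈ G`:
    (hequiv : ∀ (g : G) (f fg : Sρ),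
      ((fg : G → V) = fun x => (f : G → V) (g⁻¹ * x)) →
      ((φ fg : G → W) = fun x => (φ f : G → W) (g⁻¹ * x))) :
    -- then `φ` is a convolutional layer:
    ∃ κ : G → (V →L[ℂ] W),
      ∀ (f : Sρ) (g : G),
        (φ f : G → W) g = ∑ g' : G, κ (g⁻¹ * g') ((f : G → V) g') := by
  classical
  obtain ⟨L, hL⟩ :=
    LinearMap.exists_extend ((LinearMap.proj (1 : G) ∘ₗ Sσ.subtype) ∘ₗ φ)
  refine ⟨fun x => LinearMap.toContinuousLinearMap
    (L ∘ₗ LinearMap.single ℂ (fun _ : G => V) x), fun f g => ?_⟩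
  have hmem : (fun x => (f : G → V) (g * x)) ∈ Sρ := by
    rw [hSρ]
    intro x k
    simpa only [mul_assoc] using (hSρ f).1 f.2 (g * x) k
  have hshift : (φ f : G → W) g = L (fun x => (f : G → V) (g * x)) := by
    have hφ := congrFun (hequiv g⁻¹ f ⟨_, hmem⟩ (by simp)) 1
    have hext := LinearMap.congr_fun hL ⟨_, hmem⟩
    simp only [inv_inv, mul_one] at hφ
    exact hφ.symm.trans hext.symm
  rw [hshift, ← Equiv.sum_comp (Equiv.mulLeft g)]
  simp only [Equiv.coe_mulLeft, inv_mul_cancel_left, LinearMap.coe_toContinuousLinearMap',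
    LinearMap.comp_apply, LinearMap.coe_single]
  rw [← map_sum, Finset.univ_sum_single]
end

section
/- Let H ⊆ L²(ℝ) be a closed subspace invariant under all translations (Λ(x)f)(y) = f(y−x), and suppose there exists a continuous linear functional E : H → ℂ such that every f ∈ H satisfies f(x) = E(Λ(−x)f) for a.e. x ∈ ℝ (i.e. H is a translation-invariant reproducing kernel Hilbert subspace of L²(ℝ)). Then there exists φ ∈ H (represented by a square-integrable function) such that: (i) for every f ∈ H, the function y ↦ conj(φ(y−x)) f(y) is integrable for every x ∈ ℝ and f(x) = ∫_ℝ conj(φ(y−x)) f(y) dy for a.e. x, i.e. f = f ⋆ φ* where φ*(y) := conj(φ(−y)); (ii) φ is self-adjoint: φ(x) = conj(φ(−x)) for a.e. x; (iii) φ is a convolution idempotent: φ = φ ⋆ φ* a.e.; and (iv) every f ∈ H agrees a.e. with a continuous function. -/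
open MeasureTheory

open scoped ComplexConjugate

/-- The translates of an `L²` function depend continuously on the translation. -/
theorem exists_translate_continuous (f : Lp ℂ 2 (volume : Measure ℝ)) :
    ∃ T : ℝ → Lp ℂ 2 (volume : Measure ℝ), Continuous T ∧
      ∀ x, ⇑(T x) =ᵐ[volume] fun y => f (y + x) := by
  have : Fact ((2 : ENNReal) ≠ ⊤) := ⟨by simp⟩
  refine ⟨fun x => DomAddAct.mk x +ᵥ f, ?_, fun x => ?_⟩
  · exact (DomAddAct.continuous_mk (M := ℝ)).vadd continuous_const
  · filter_upwards [DomAddAct.vadd_Lp_ae_eq (DomAddAct.mk x) f] with y hy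
    rw [hy, Equiv.symm_apply_apply, vadd_eq_add, add_comm]

theorem integral_conj_translate_mul (f g : ℝ → ℂ) (x : ℝ) :
    ∫ y, conj (g (y - x)) * f y = ∫ y, conj (g y) * f (y + x) := by
  simpa using (integral_add_right_eq_self (fun y => conj (g (y - x)) * f y) x).symm

theorem integrable_conj_translate_mul (f g : Lp ℂ 2 (volume : Measure ℝ)) (x : ℝ) :
    Integrable (fun y => conj (g (y - x)) * f y) := by
  have hg : MemLp (fun y => g (y - x)) 2 volume :=
    (Lp.memLp g).comp_measurePreserving (measurePreserving_sub_right volume x)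
  exact hg.star.integrable_mul (Lp.memLp f)

theorem inner_translate_eq_integral (f g h : Lp ℂ 2 (volume : Measure ℝ)) (x : ℝ)
    (hh : ⇑h =ᵐ[volume] fun y => f (y + x)) :
    inner ℂ g h = ∫ y, conj (g (y - x)) * f y := by
  rw [integral_conj_translate_mul, L2.inner_def]
  refine integral_congr_ae ?_
  filter_upwards [hh] with y hy
  simp [hy, mul_comm]


/-- Let `H ⊆ L²(ℝ)` be a closed subspace invariant under all translations
`(Λ(x) f)(y) = f (y - x)`, and suppose there is a continuous linear functional `E : H → ℂ` with
`f(x) = E (Λ(-x) f)` for a.e. `x`, for every `f ∈ H` (a translation-invariant reproducing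
kernel Hilbert subspace of `L²(ℝ)`).  Then there exists `φ ∈ H` such that:
(i) every `f ∈ H` satisfies `f = f ⋆ φ*`, i.e. `y ↦ conj (φ (y - x)) * f y` is integrable for
every `x` and `f x = ∫ conj (φ (y - x)) * f y dy` for a.e. `x`;
(ii) `φ` is self-adjoint: `φ x = conj (φ (-x))` for a.e. `x`;
(iii) `φ` is a convolution idempotent: `φ = φ ⋆ φ*` a.e.;
(iv) every `f ∈ H` agrees a.e. with a continuous function.

The translate `Λ(x) f` (resp. `Λ(-x) f`) of an element of `H` is encoded by any `L²` element
whose representative is a.e. equal to `y ↦ f (y - x)` (resp. `y ↦ f (y + x)`). -/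
theorem translation_invariant_RKHS_convolution_idempotent
    (H : Submodule ℂ (Lp ℂ 2 (volume : Measure ℝ)))
    (hclosed : IsClosed (H : Set (Lp ℂ 2 (volume : Measure ℝ))))
    -- invariance under all translations:
    (hinv : ∀ x : ℝ, ∀ f ∈ H, ∀ f' : Lp ℂ 2 (volume : Measure ℝ),
      (⇑f' =ᵐ[volume] fun y => f (y - x)) → f' ∈ H)
    -- reproducing hypothesis: `f(x) = E (Λ(-x) f)` for a.e. `x`:
    (hRKHS : ∃ E : H →L[ℂ] ℂ, ∀ (f : H) (T : ℝ → H),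
      (∀ x : ℝ, ⇑(T x : Lp ℂ 2 (volume : Measure ℝ)) =ᵐ[volume]
        fun y => (f : Lp ℂ 2 (volume : Measure ℝ)) (y + x)) →
      ⇑(f : Lp ℂ 2 (volume : Measure ℝ)) =ᵐ[volume] fun x => E (T x)) :
    ∃ φ : Lp ℂ 2 (volume : Measure ℝ), φ ∈ H ∧
      -- (i) every `f ∈ H` is reproduced: `f = f ⋆ φ*`:
      (∀ f ∈ H,
        (∀ x : ℝ, Integrable (fun y => (starRingEnd ℂ) (φ (y - x)) * f y) volume) ∧
        ⇑f =ᵐ[volume] fun x => ∫ y, (starRingEnd ℂ) (φ (y - x)) * f y) ∧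
      -- (ii) `φ` is self-adjoint: `φ = φ*`:
      (⇑φ =ᵐ[volume] fun x => (starRingEnd ℂ) (φ (-x))) ∧
      -- (iii) `φ` is a convolution idempotent: `φ = φ ⋆ φ*`:
      ((∀ x : ℝ, Integrable (fun y => φ (x - y) * (starRingEnd ℂ) (φ (-y))) volume) ∧
        ⇑φ =ᵐ[volume] fun x => ∫ y, φ (x - y) * (starRingEnd ℂ) (φ (-y))) ∧
      -- (iv) every `f ∈ H` agrees a.e. with a continuous function:
      (∀ f ∈ H, ∃ fc : ℝ → ℂ, Continuous fc ∧ ⇑f =ᵐ[volume] fc) := by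
  obtain ⟨E, hE⟩ := hRKHS
  have : CompleteSpace H := hclosed.completeSpace_coe
  let φ : H := (InnerProductSpace.toDual ℂ H).symm E
  have hφ (f : H) : E f = inner ℂ (φ : Lp ℂ 2 (volume : Measure ℝ)) f := by
    rw [← Submodule.coe_inner, InnerProductSpace.toDual_symm_apply]
  have key (f) (hf : f ∈ H) :
      Continuous (fun x : ℝ => ∫ y, conj ((φ : Lp ℂ 2 (volume : Measure ℝ)) (y - x)) * f y) ∧
      ⇑f =ᵐ[volume] fun x => ∫ y, conj ((φ : Lp ℂ 2 (volume : Measure ℝ)) (y - x)) * f y := by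
    obtain ⟨T, hTc, hT⟩ := exists_translate_continuous f
    have hTH (x : ℝ) : T x ∈ H := hinv (-x) f hf _ (by simpa using hT x)
    have hin (x : ℝ) := inner_translate_eq_integral f φ (T x) x (hT x)
    simp_rw [← hin]
    refine ⟨by fun_prop, ?_⟩
    simpa only [hφ] using hE ⟨f, hf⟩ (fun x => ⟨T x, hTH x⟩) hT
  refine ⟨φ, φ.2, fun f hf => ⟨integrable_conj_translate_mul f φ, (key f hf).2⟩, ?_, ⟨?_, ?_⟩,
    fun f hf => ⟨_, key f hf⟩⟩
  · have h := (key φ φ.2).2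
    have hneg := (Measure.measurePreserving_neg (volume : Measure ℝ)).quasiMeasurePreserving.ae h
    filter_upwards [h, hneg] with x hx hx'
    rw [hx, hx', ← integral_conj, integral_conj_translate_mul]
    simp [mul_comm]
  · intro x
    simpa [mul_comm] using (integrable_conj_translate_mul φ φ x).comp_sub_left x
  · filter_upwards [(key φ φ.2).2] with x hx
    rw [hx, ← integral_sub_left_eq_self _ volume x]
    simp [mul_comm]
end
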